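/- Let G be a finite group, k a field, and N ∈ ℕ. Suppose G acts on R := MvPolynomial (Fin N) k by a multiplicative semiring action such that g • C(c) = C(c) for every g ∈ G and c ∈ k, each g • Xᵢ is a homogeneous polynomial of degree 1, and the action is faithful. If f₁, …, f_N ∈ R satisfy g • fᵢ = fᵢ for all g ∈ G and all i, the family f₁, …, f_N is algebraically independent over k, and totalDegree(fᵢ) ≤ d for all i, then |G| ≤ d^N. (Theorem 'Lower bound, general form': γ_field(G,V) ≥ |G|^{1/N} for any finite group G and faithful N-dimensional representation V.) -/

import Mathlib

open MvPolynomial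

/-- The lattice points of the standard `N`-simplex dilated by `m`. -/
def simplexPoints (N m : ℕ) : Finset (Fin N → ℕ) :=
  {x ∈ Fintype.piFinset fun _ => Finset.range (m + 1) | ∑ i, x i ≤ m}

theorem mem_simplexPoints {N m : ℕ} {x : Fin N → ℕ} : x ∈ simplexPoints N m ↔ ∑ i, x i ≤ m := by
  simp only [simplexPoints, Finset.mem_filter, Fintype.mem_piFinset, Finset.mem_range,
    and_iff_right_iff_imp, Nat.lt_succ_iff]
  exact fun h i => (Finset.single_le_sum (fun _ _ => Nat.zero_le _) (Finset.mem_univ i)).trans h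

theorem card_simplexPoints_le (N m : ℕ) : (simplexPoints N m).card ≤ (m + 1) ^ N := by
  refine (Finset.card_filter_le _ _).trans ?_
  simp

theorem card_simplexPoints_pos (N m : ℕ) : 0 < (simplexPoints N m).card :=
  Finset.card_pos.2 ⟨0, mem_simplexPoints.2 (by simp)⟩

theorem card_simplexPoints_mul_le (N m : ℕ) {d : ℕ} (hd : 0 < d) :
    (simplexPoints N (d * m)).card ≤ d ^ N * (simplexPoints N m).card := by
  have hcard : ((Fintype.piFinset fun _ : Fin N => Finset.range d) ×ˢ simplexPoints N m).card =
      d ^ N * (simplexPoints N m).card := by simp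
  rw [← hcard]
  refine Finset.card_le_card_of_injOn (fun x => (fun i => x i % d, fun i => x i / d)) ?_ ?_
  · intro x hx
    have hx' := mem_simplexPoints.1 (Finset.mem_coe.1 hx)
    simp only [Finset.coe_product, Set.mem_prod, Finset.mem_coe, Fintype.mem_piFinset,
      Finset.mem_range, mem_simplexPoints]
    refine ⟨fun i => Nat.mod_lt _ hd, Nat.le_of_mul_le_mul_left ?_ hd⟩
    rw [Finset.mul_sum]
    exact (Finset.sum_le_sum fun i _ => Nat.mul_div_le (x i) d).trans hx'
  · intro x _ y _ hxy
    simp only [Prod.mk.injEq, funext_iff] at hxy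
    ext i
    rw [← Nat.div_add_mod (x i) d, ← Nat.div_add_mod (y i) d, hxy.1 i, hxy.2 i]

theorem finrank_restrictTotalDegree (k : Type*) [Field k] (N m : ℕ) :
    Module.finrank k (restrictTotalDegree (Fin N) k m) = (simplexPoints N m).card := by
  rw [restrictTotalDegree, Module.finrank_eq_nat_card_basis (basisRestrictSupport k _),
    ← Nat.card_eq_finsetCard]
  refine Nat.card_congr (Finsupp.equivFunOnFinite.subtypeEquiv fun x => ?_)
  rw [mem_simplexPoints, Set.mem_ofPred_eq, Finsupp.sum_fintype _ _ fun _ => rfl]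
  rfl

instance (k : Type*) [Field k] (N m : ℕ) :
    Module.Finite k (restrictTotalDegree (Fin N) k m) := by
  refine Module.finite_of_finrank_pos ?_
  rw [finrank_restrictTotalDegree]
  exact card_simplexPoints_pos N m

theorem totalDegree_aeval_le {σ τ R : Type*} [CommSemiring R] (f : σ → MvPolynomial τ R) {d : ℕ}
    (hf : ∀ i, (f i).totalDegree ≤ d) (p : MvPolynomial σ R) :
    (aeval f p).totalDegree ≤ d * p.totalDegree := by
  rw [aeval_def, eval₂_eq]
  refine totalDegree_finsetSum_le fun s hs => ?_
  have hs' : ∑ i ∈ s.support, s i ≤ p.totalDegree := le_totalDegree hs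
  calc _ ≤ (C (p.coeff s) : MvPolynomial τ R).totalDegree +
        (∏ i ∈ s.support, f i ^ s i).totalDegree := totalDegree_mul _ _
    _ ≤ 0 + ∑ i ∈ s.support, s i * d := by
      refine add_le_add (totalDegree_C _).le ((totalDegree_finsetProd _ _).trans ?_)
      exact Finset.sum_le_sum fun i _ => (totalDegree_pow _ _).trans (Nat.mul_le_mul_left _ (hf i))
    _ ≤ d * p.totalDegree := by
      rw [zero_add, ← Finset.sum_mul, mul_comm]
      exact Nat.mul_le_mul_left _ hs'

/-- A domain with a faithful action of a finite group `G` contains `|G|` elements that are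
linearly independent over the invariants. -/
theorem exists_independent_over_invariants (G R : Type*) [Group G] [Fintype G] [CommRing R]
    [IsDomain R] [MulSemiringAction G R] [FaithfulSMul G R] :
    ∃ h : Fin (Fintype.card G) → R, ∀ a : Fin (Fintype.card G) → R,
      (∀ (g : G) j, g • a j = a j) → ∑ j, a j * h j = 0 → a = 0 := by
  let K := FractionRing R
  let φ : G → R →* K := fun g =>
    (algebraMap R K : R →* K).comp (MulSemiringAction.toRingHom G R g : R →* R)
  have hφ : Function.Injective φ := fun g g' hgg' => eq_of_smul_eq_smul (α := R) fun x =>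
    IsFractionRing.injective R K (DFunLike.congr_fun hgg' x)
  have hspan := span_flip_eq_top_iff_linearIndependent.2
    ((linearIndependent_monoidHom R K).comp φ hφ)
  obtain ⟨v, hv, hind⟩ : ∃ v : Fin (Fintype.card G) → G → K,
      (∀ j, v j ∈ Set.range (flip ((fun ψ : R →* K => (ψ : R → K)) ∘ φ))) ∧
        LinearIndependent K v := by
    have hrank : Module.finrank K (Submodule.span K
        (Set.range (flip ((fun ψ : R →* K => (ψ : R → K)) ∘ φ)))) = Fintype.card G := by
      rw [hspan, finrank_top, Module.finrank_fintype_fun_eq_card]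
    obtain ⟨v, hv, -, hind⟩ := Submodule.exists_fun_fin_finrank_span_eq K
      (Set.range (flip ((fun ψ : R →* K => (ψ : R → K)) ∘ φ)))
    exact ⟨v ∘ finCongr hrank.symm, fun j => hv _, hind.comp _ (finCongr hrank.symm).injective⟩
  choose h hh using hv
  refine ⟨h, fun a ha hsum => funext fun j => IsFractionRing.injective R K ?_⟩
  rw [Pi.zero_apply, map_zero]
  refine Fintype.linearIndependent_iff.1 hind (fun j => algebraMap R K (a j)) (funext fun g => ?_) j
  have hg : ∑ j, a j * g • h j = 0 := by
    simpa [Finset.smul_sum, smul_mul', ha] using congrArg (g • ·) hsum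
  have hv : ∀ j, v j g = algebraMap R K (g • h j) := fun j => by rw [← hh j]; rfl
  simpa [hv, Algebra.smul_def] using congrArg (algebraMap R K) hg

theorem le_of_forall_card_mul_simplexPoints_le {n c N e : ℕ}
    (H : ∀ m, n * (simplexPoints N m).card ≤ c * (simplexPoints N (m + e)).card) : n ≤ c := by
  by_contra! hlt
  have hpow : ∀ j, n ^ j ≤ c ^ j * (simplexPoints N (j * e)).card := by
    intro j
    induction j with
    | zero => simpa using card_simplexPoints_pos N _
    | succ j ih =>
      calc n ^ (j + 1) = n * n ^ j := pow_succ' _ _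
        _ ≤ n * (c ^ j * (simplexPoints N (j * e)).card) := Nat.mul_le_mul_left _ ih
        _ = c ^ j * (n * (simplexPoints N (j * e)).card) := by ring
        _ ≤ c ^ j * (c * (simplexPoints N (j * e + e)).card) := Nat.mul_le_mul_left _ (H _)
        _ = _ := by rw [add_one_mul]; ring
  have hn : (0 : ℝ) < n := by exact_mod_cast (Nat.zero_le c).trans_lt hlt
  have hlim := (tendsto_pow_const_mul_const_pow_of_lt_one N (r := (c : ℝ) / n) (by positivity)
    ((div_lt_one hn).2 (by exact_mod_cast hlt))).const_mul (((e + 1 : ℕ) : ℝ) ^ N)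
  rw [mul_zero] at hlim
  obtain ⟨j, hj, hj1⟩ := ((hlim.eventually (gt_mem_nhds one_pos)).and
    (Filter.eventually_ge_atTop 1)).exists
  have hle : n ^ j ≤ c ^ j * ((e + 1) * j) ^ N :=
    (hpow j).trans (Nat.mul_le_mul_left _ ((card_simplexPoints_le N _).trans
      (Nat.pow_le_pow_left (by nlinarith) N)))
  have hle' : (n : ℝ) ^ j ≤ (c : ℝ) ^ j * (((e + 1 : ℕ) : ℝ) * j) ^ N := by exact_mod_cast hle
  rw [div_pow, mul_div_assoc', mul_div_assoc', div_lt_one (by positivity)] at hj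
  rw [mul_pow] at hle'
  linarith

theorem card_mul_simplexPoints_le {k : Type*} [Field k] {N n d e : ℕ}
    {f : Fin N → MvPolynomial (Fin N) k} (hdeg : ∀ i, (f i).totalDegree ≤ d)
    {h : Fin n → MvPolynomial (Fin N) k} (hh : ∀ j, (h j).totalDegree ≤ d * e)
    (hind : ∀ p : Fin n → MvPolynomial (Fin N) k, ∑ j, aeval f (p j) * h j = 0 → p = 0) (m : ℕ) :
    n * (simplexPoints N m).card ≤ (simplexPoints N (d * (m + e))).card := by
  let L : (Fin n → restrictTotalDegree (Fin N) k m) →ₗ[k] MvPolynomial (Fin N) k :=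
    ∑ j, (LinearMap.mulRight k (h j)) ∘ₗ (aeval f).toLinearMap ∘ₗ
      (restrictTotalDegree (Fin N) k m).subtype ∘ₗ LinearMap.proj j
  have hL : ∀ p, L p = ∑ j, aeval f (p j : MvPolynomial (Fin N) k) * h j := fun p => by simp [L]
  have hmem : ∀ p, L p ∈ restrictTotalDegree (Fin N) k (d * (m + e)) := fun p => by
    rw [mem_restrictTotalDegree, hL]
    refine totalDegree_finsetSum_le fun j _ => (totalDegree_mul _ _).trans ?_
    rw [mul_add]
    refine add_le_add ((totalDegree_aeval_le f hdeg _).trans (Nat.mul_le_mul_left _ ?_)) (hh j)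
    exact (mem_restrictTotalDegree _ _ _).1 (p j).2
  have hinj : Function.Injective (L.codRestrict _ hmem) := by
    refine (injective_iff_map_eq_zero _).2 fun p hp => ?_
    have h0 := hind (fun j => p j) ((hL p).symm.trans (congrArg Subtype.val hp))
    exact funext fun j => Subtype.ext (congrFun h0 j)
  have := LinearMap.finrank_le_finrank_of_injective hinj
  simpa [Module.finrank_pi_fintype, finrank_restrictTotalDegree] using this

theorem card_le_pow_of_invariants (G : Type*) [Group G] [Fintype G] (k : Type*) [Field k] (N : ℕ)
    [MulSemiringAction G (MvPolynomial (Fin N) k)] [FaithfulSMul G (MvPolynomial (Fin N) k)]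
    (hC : ∀ (g : G) (c : k), g • (C c : MvPolynomial (Fin N) k) = C c)
    {d : ℕ} (hd : 0 < d) {f : Fin N → MvPolynomial (Fin N) k}
    (hinv : ∀ (g : G) (i : Fin N), g • f i = f i) (halg : AlgebraicIndependent k f)
    (hdeg : ∀ i, (f i).totalDegree ≤ d) :
    Fintype.card G ≤ d ^ N := by
  obtain ⟨h, hh⟩ := exists_independent_over_invariants G (MvPolynomial (Fin N) k)
  have hfix : ∀ (g : G) (p : MvPolynomial (Fin N) k), g • aeval f p = aeval f p := fun g p => by
    induction p using MvPolynomial.induction_on with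
    | C c => simpa [algebraMap_eq] using hC g c
    | add p q hp hq => rw [map_add, smul_add, hp, hq]
    | mul_X p i hp => rw [map_mul, smul_mul', hp, aeval_X, hinv]
  refine le_of_forall_card_mul_simplexPoints_le (N := N)
    (e := Finset.univ.sup fun j => (h j).totalDegree) fun m => ?_
  refine (card_mul_simplexPoints_le hdeg (h := h) (fun j => ?_) (fun p hp => ?_) m).trans
    (card_simplexPoints_mul_le N _ hd)
  · exact (Finset.le_sup (f := fun j => (h j).totalDegree) (Finset.mem_univ j)).trans
      (Nat.le_mul_of_pos_left _ hd)
  · have := hh (fun j => aeval f (p j)) (fun g j => hfix g _) hp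
    exact funext fun j => halg.eq_zero_of_aeval_eq_zero _ (congrFun this j)

/-- If a finite group `G` acts faithfully on `k[X₁,…,X_N]` by degree-preserving
`k`-algebra automorphisms (constants are fixed, each `g • Xᵢ` is homogeneous of degree 1), and
`f₁, …, f_N` are `G`-invariant, algebraically independent over `k`, of total degree `≤ d`, then
`|G| ≤ d ^ N`. -/
theorem stmt_1 (G : Type*) [Group G] [Fintype G] (k : Type*) [Field k] (N : ℕ)
    [MulSemiringAction G (MvPolynomial (Fin N) k)]
    (hC : ∀ (g : G) (c : k), g • (MvPolynomial.C c : MvPolynomial (Fin N) k) = MvPolynomial.C c)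
    (hX : ∀ (g : G) (i : Fin N),
      ((g • (MvPolynomial.X i : MvPolynomial (Fin N) k)).IsHomogeneous 1))
    (hfaithful : ∀ g h : G, (∀ f : MvPolynomial (Fin N) k, g • f = h • f) → g = h)
    (d : ℕ) (f : Fin N → MvPolynomial (Fin N) k)
    (hinv : ∀ (g : G) (i : Fin N), g • f i = f i)
    (halg : AlgebraicIndependent k f)
    (hdeg : ∀ i, (f i).totalDegree ≤ d) :
    Fintype.card G ≤ d ^ N := by
  have : FaithfulSMul G (MvPolynomial (Fin N) k) := ⟨fun h => hfaithful _ _ h⟩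
  rcases Nat.eq_zero_or_pos d with rfl | hd
  · rcases Nat.eq_zero_or_pos N with rfl | hN
    · simpa using card_le_pow_of_invariants G k 0 hC one_pos hinv halg fun i => i.elim0
    · have hf := totalDegree_eq_zero_iff_eq_C.1 (Nat.le_zero.1 (hdeg ⟨0, hN⟩))
      refine absurd ?_ (halg.transcendental ⟨0, hN⟩)
      rw [hf]
      simpa [algebraMap_eq] using isAlgebraic_algebraMap (A := MvPolynomial (Fin N) k)
        ((f ⟨0, hN⟩).coeff 0)
  · exact card_le_pow_of_invariants G k N hC hd hinv halg hdeg
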